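/- arXiv:1410.6396 — 6 statements merged into one kernel-verified Lean document; each statement's English description precedes it below -/
import Mathlib

section
/- Let n ≥ 1 and let J₁,…,J_{n−1} be positive integers. Then the following are equivalent: (1) there exists a permutation x₁,…,x_n of the integers {0,…,n−1} with x₁ = 0 and |x_{i+1} − x_i| = J_i for all 1 ≤ i ≤ n−1; (2) there exists a permutation π₁,…,π_{n+1} of the integers {1,…,n+1} with |π₂ − π₁| = n and |π_{i+2} − π_{i+1}| = J_i for all 1 ≤ i ≤ n−1. -/
/-- Prepending the new maximum `n + 1` to a permutation of `{0, …, n - 1}` shifted up by one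
gives a permutation of `{1, …, n + 1}`. -/
theorem bijOn_prepend_max {n : ℕ} {x : ℕ → ℤ}
    (hx : Set.BijOn x (Set.Icc 1 n) (Set.Icc (0 : ℤ) (n - 1))) :
    Set.BijOn (fun i => if i = 1 then (n : ℤ) + 1 else x (i - 1) + 1)
      (Set.Icc 1 (n + 1)) (Set.Icc (1 : ℤ) (n + 1)) := by
  obtain ⟨hmaps, hinj, hsurj⟩ := hx
  have hbound : ∀ i, 1 ≤ i → i ≤ n → 0 ≤ x i ∧ x i ≤ n - 1 := fun i h1 h2 => hmaps ⟨h1, h2⟩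
  refine ⟨fun i hi => ?_, fun i hi j hj hij => ?_, fun y hy => ?_⟩
  · rw [Set.mem_Icc] at hi
    have := hbound (i - 1)
    dsimp only
    rw [Set.mem_Icc]
    split_ifs <;> omega
  · rw [Set.mem_Icc] at hi hj
    have hbi := hbound (i - 1)
    have hbj := hbound (j - 1)
    dsimp only at hij
    split_ifs at hij
    · omega
    · omega
    · omega
    · have := hinj (show i - 1 ∈ Set.Icc 1 n from ⟨by omega, by omega⟩)
        (show j - 1 ∈ Set.Icc 1 n from ⟨by omega, by omega⟩) (by omega)
      omega
  · rw [Set.mem_Icc] at hy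
    by_cases hmax : y = n + 1
    · exact ⟨1, ⟨le_rfl, by omega⟩, by simp [hmax]⟩
    · obtain ⟨i, ⟨hi1, hi2⟩, hxi⟩ :=
        hsurj (show y - 1 ∈ Set.Icc (0 : ℤ) (n - 1) from ⟨by omega, by omega⟩)
      refine ⟨i + 1, ⟨by omega, by omega⟩, ?_⟩
      simp only [Nat.add_sub_cancel]
      rw [if_neg (by omega)]
      omega

/-- Removing the leading maximum `n + 1` from a permutation of `{1, …, n + 1}` and shifting down
by one gives a permutation of `{0, …, n - 1}`. -/
theorem bijOn_remove_max {n : ℕ} {π : ℕ → ℤ}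
    (hπ : Set.BijOn π (Set.Icc 1 (n + 1)) (Set.Icc (1 : ℤ) (n + 1))) (hmax : π 1 = n + 1) :
    Set.BijOn (fun i => π (i + 1) - 1) (Set.Icc 1 n) (Set.Icc (0 : ℤ) (n - 1)) := by
  obtain ⟨hmaps, hinj, hsurj⟩ := hπ
  refine ⟨fun i hi => ?_, fun i hi j hj hij => ?_, fun y hy => ?_⟩
  · rw [Set.mem_Icc] at hi
    have hmem : i + 1 ∈ Set.Icc 1 (n + 1) := ⟨by omega, by omega⟩
    have hb := hmaps hmem
    have hne : π (i + 1) ≠ π 1 := fun h => by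
      have := hinj hmem (show 1 ∈ Set.Icc 1 (n + 1) from ⟨le_rfl, by omega⟩) h
      omega
    dsimp only
    rw [Set.mem_Icc] at hb ⊢
    omega
  · rw [Set.mem_Icc] at hi hj
    dsimp only at hij
    have := hinj (show i + 1 ∈ Set.Icc 1 (n + 1) from ⟨by omega, by omega⟩)
      (show j + 1 ∈ Set.Icc 1 (n + 1) from ⟨by omega, by omega⟩) (by omega)
    omega
  · rw [Set.mem_Icc] at hy
    obtain ⟨i, ⟨hi1, hi2⟩, hi⟩ :=
      hsurj (show y + 1 ∈ Set.Icc (1 : ℤ) (n + 1) from ⟨by omega, by omega⟩)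
    have hne : i ≠ 1 := by
      rintro rfl
      omega
    refine ⟨i - 1, ⟨by omega, by omega⟩, ?_⟩
    dsimp only
    rw [Nat.sub_add_cancel hi1]
    omega

/-- Reflecting a permutation of `{1, …, n + 1}` through `y ↦ n + 2 - y` gives a permutation. -/
theorem bijOn_reflect {n : ℕ} {π : ℕ → ℤ} {s : Set ℕ}
    (hπ : Set.BijOn π s (Set.Icc (1 : ℤ) (n + 1))) :
    Set.BijOn (fun i => (n : ℤ) + 2 - π i) s (Set.Icc (1 : ℤ) (n + 1)) := by
  obtain ⟨hmaps, hinj, hsurj⟩ := hπ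
  refine ⟨fun i hi => ?_, fun i hi j hj hij => hinj hi hj (sub_right_injective hij),
    fun y hy => ?_⟩
  · have hb := hmaps hi
    dsimp only
    rw [Set.mem_Icc] at hb ⊢
    omega
  · rw [Set.mem_Icc] at hy
    obtain ⟨i, hi, hπi⟩ :=
      hsurj (show (n : ℤ) + 2 - y ∈ Set.Icc (1 : ℤ) (n + 1) from ⟨by omega, by omega⟩)
    exact ⟨i, hi, by dsimp only; omega⟩

/-- Solvability of the 1-D Crazy Frog Puzzle on an empty board of
`n` cells `0,…,n-1`, frog starting at cell `0` with jumps `J 1, …, J (n-1)`,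
is equivalent to the Permutation Reconstruction from Differences instance with
difference sequence `n, J 1, …, J (n-1)`. -/
theorem stmt_2 (n : ℕ) (hn : 1 ≤ n) (J : ℕ → ℤ)
    (hJ : ∀ i, 1 ≤ i → i ≤ n - 1 → 0 < J i) :
    (∃ x : ℕ → ℤ, Set.BijOn x (Set.Icc 1 n) (Set.Icc (0 : ℤ) (n - 1)) ∧
        x 1 = 0 ∧ ∀ i, 1 ≤ i → i ≤ n - 1 → |x (i + 1) - x i| = J i) ↔
    (∃ π : ℕ → ℤ, Set.BijOn π (Set.Icc 1 (n + 1)) (Set.Icc (1 : ℤ) (n + 1)) ∧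
        |π 2 - π 1| = n ∧ ∀ i, 1 ≤ i → i ≤ n - 1 → |π (i + 2) - π (i + 1)| = J i) := by
  constructor
  · rintro ⟨x, hx, hx1, hdiff⟩
    refine ⟨_, bijOn_prepend_max hx, by simp [hx1], fun i hi1 hi2 => ?_⟩
    simpa [show i ≠ 0 by omega] using hdiff i hi1 hi2
  · rintro ⟨π, hπ, hfirst, hdiff⟩
    have hb1 := hπ.mapsTo (show 1 ∈ Set.Icc 1 (n + 1) from ⟨le_rfl, by omega⟩)
    have hb2 := hπ.mapsTo (show 2 ∈ Set.Icc 1 (n + 1) from ⟨by omega, by omega⟩)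
    rw [Set.mem_Icc] at hb1 hb2
    rcases (abs_eq (by omega)).1 hfirst with h | h
    · refine ⟨_, bijOn_remove_max (bijOn_reflect hπ) (by omega), by norm_num; omega,
        fun i hi1 hi2 => ?_⟩
      rw [← hdiff i hi1 hi2, abs_sub_comm (π (i + 2))]
      congr 1
      ring
    · refine ⟨_, bijOn_remove_max hπ (by omega), by norm_num; omega, fun i hi1 hi2 => ?_⟩
      rw [← hdiff i hi1 hi2]
      congr 1
      ring
end

section
/- Let N ≥ 1, let B ⊆ {0,…,N−1} be a set of blocked cells, let c₀ ∉ B be a starting cell, and let J₁,…,J_m be positive integers with m + 1 equal to the number of non-blocked cells. Then the 1-D Crazy Frog instance (board length N, blocked set B, start c₀, jumps J₁,…,J_m) has a solution if and only if the 1-D Crazy Frog instance with board length N+1, blocked set {b+1 : b ∈ B}, starting cell 0, and jump sequence (c₀+1), J₁,…,J_m has a solution. -/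
/-- Solvability of a 1-D Crazy Frog instance: board of `N` cells `0,…,N-1`,
blocked set `B`, starting cell `c₀`, and `m` jumps `J 1, …, J m`.  A solution is a
choice of signs `s i ∈ {-1,+1}` such that the positions `x 0 = c₀`,
`x i = x (i-1) + s i * J i` form a bijection from `{0,…,m}` onto the set of
non-blocked cells of the board (in particular they stay on the board, avoid the
blocked cells, are pairwise distinct, and cover every non-blocked cell). -/
def CrazyFrog1D (N : ℕ) (B : Set ℤ) (c₀ : ℤ) (m : ℕ) (J : ℕ → ℤ) : Prop :=
  ∃ s : ℕ → ℤ, (∀ i, 1 ≤ i → i ≤ m → s i = 1 ∨ s i = -1) ∧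
    ∃ x : ℕ → ℤ, x 0 = c₀ ∧
      (∀ i, 1 ≤ i → i ≤ m → x i = x (i - 1) + s i * J i) ∧
      Set.BijOn x (Set.Icc 0 m) ({z : ℤ | 0 ≤ z ∧ z < N} \ B)

theorem bijOn_Icc_succ_iff_of_shift (N : ℕ) (B : Set ℤ) (hB : B ⊆ {z : ℤ | 0 ≤ z ∧ z < N}) (m : ℕ)
    (x y : ℕ → ℤ) (hy0 : y 0 = 0) (hy : ∀ i, y (i + 1) = x i + 1) :
    Set.BijOn x (Set.Icc 0 m) ({z : ℤ | 0 ≤ z ∧ z < N} \ B) ↔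
      Set.BijOn y (Set.Icc 0 (m + 1))
        ({z : ℤ | 0 ≤ z ∧ z < (N + 1 : ℕ)} \ (fun b => b + 1) '' B) := by
  have hsucc : ∀ z : ℤ, z + 1 ∈ (fun b : ℤ => b + 1) '' B ↔ z ∈ B := fun z => by simp
  have hzero : (0 : ℤ) ∉ (fun b : ℤ => b + 1) '' B := by
    rintro ⟨b, hb, h⟩
    have := (hB hb).1
    dsimp only at h
    omega
  constructor
  · rintro ⟨hmaps, hinj, hsurj⟩
    refine ⟨?_, ?_, ?_⟩
    · rintro (_ | i) hi
      · rw [hy0]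
        exact ⟨⟨le_rfl, by omega⟩, hzero⟩
      · obtain ⟨⟨h₁, h₂⟩, h₃⟩ := hmaps (show i ∈ Set.Icc 0 m from ⟨i.zero_le, by grind⟩)
        rw [hy]
        exact ⟨⟨by omega, by push_cast; omega⟩, fun h => h₃ ((hsucc _).1 h)⟩
    · have hne : ∀ i, i + 1 ∈ Set.Icc 0 (m + 1) → x i + 1 ≠ 0 := fun i hi => by
        have := (hmaps (show i ∈ Set.Icc 0 m from ⟨i.zero_le, by grind⟩)).1.1
        omega
      rintro (_ | i) hi (_ | j) hj hij
      · rfl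
      · rw [hy0, hy] at hij
        exact absurd hij.symm (hne j hj)
      · rw [hy0, hy] at hij
        exact absurd hij (hne i hi)
      · rw [hy, hy] at hij
        rw [hinj ⟨i.zero_le, by grind⟩ ⟨j.zero_le, by grind⟩ (by omega : x i = x j)]
    · rintro z ⟨⟨h₁, h₂⟩, h₃⟩
      rcases h₁.eq_or_lt with rfl | hz
      · exact ⟨0, by simp, hy0⟩
      · obtain ⟨w, rfl⟩ : ∃ w, z = w + 1 := ⟨z - 1, by ring⟩
        obtain ⟨i, hi, rfl⟩ := hsurj (show w ∈ {z : ℤ | 0 ≤ z ∧ z < N} \ B from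
          ⟨⟨by omega, by push_cast at h₂; omega⟩, fun h => h₃ ((hsucc _).2 h)⟩)
        exact ⟨i + 1, ⟨by omega, by grind⟩, hy i⟩
  · rintro ⟨hmaps, hinj, hsurj⟩
    have hmem : ∀ i ∈ Set.Icc 0 m, i + 1 ∈ Set.Icc 0 (m + 1) := fun i hi =>
      ⟨by omega, by grind⟩
    refine ⟨?_, ?_, ?_⟩
    · intro i hi
      obtain ⟨⟨h₁, h₂⟩, h₃⟩ := hmaps (hmem i hi)
      have hne : y (i + 1) ≠ y 0 := fun h =>
        absurd (hinj (hmem i hi) (by simp) h) i.succ_ne_zero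
      rw [hy0] at hne
      rw [hy] at h₁ h₂ h₃ hne
      exact ⟨⟨by omega, by push_cast at h₂; omega⟩, fun h => h₃ ((hsucc _).2 h)⟩
    · intro i hi j hj hij
      have := hinj (hmem i hi) (hmem j hj) (by rw [hy, hy, hij])
      omega
    · rintro z ⟨⟨h₁, h₂⟩, h₃⟩
      obtain ⟨_ | i, hi, hz⟩ := hsurj (show z + 1 ∈ _ from
        ⟨⟨by omega, by push_cast; omega⟩, fun h => h₃ ((hsucc _).1 h)⟩)
      · rw [hy0] at hz
        omega
      · rw [hy] at hz
        exact ⟨i, ⟨i.zero_le, by grind⟩, by omega⟩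

/-- A 1-D Crazy Frog instance has a solution iff the instance
obtained by adding one cell on the left (shifting the blocked cells by one),
starting the frog at the new leftmost cell `0` and prepending a jump of length
`c₀ + 1`, has a solution. -/
theorem stmt_3 (N : ℕ) (hN : 1 ≤ N) (B : Set ℤ) (hB : B ⊆ {z : ℤ | 0 ≤ z ∧ z < N})
    (c₀ : ℤ) (hc₀ : 0 ≤ c₀ ∧ c₀ < N) (hc₀B : c₀ ∉ B)
    (m : ℕ) (J : ℕ → ℤ) (hJ : ∀ i, 1 ≤ i → i ≤ m → 0 < J i)
    (hm : ({z : ℤ | 0 ≤ z ∧ z < N} \ B).ncard = m + 1) :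
    CrazyFrog1D N B c₀ m J ↔
      CrazyFrog1D (N + 1) ((fun b => b + 1) '' B) 0 (m + 1)
        (fun i => if i = 1 then c₀ + 1 else J (i - 1)) := by
  constructor
  · rintro ⟨s, hs, x, hx0, hx, hbij⟩
    refine ⟨fun i => if i = 1 then 1 else s (i - 1), fun i h₁ h₂ => ?_,
      fun i => if i = 0 then 0 else x (i - 1) + 1, by simp, fun i h₁ h₂ => ?_,
      (bijOn_Icc_succ_iff_of_shift N B hB m x _ (by simp) (by simp)).1 hbij⟩
    · by_cases h : i = 1
      · simp [h]
      · simpa [h] using hs (i - 1) (by omega) (by omega)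
    · by_cases h : i = 1
      · simp [h, hx0]
      · have := hx (i - 1) (by omega) (by omega)
        simp only [h, if_false, show i ≠ 0 by omega, show i - 1 ≠ 0 by omega]
        rw [this]
        ring
  · rintro ⟨s, hs, x, hx0, hx, hbij⟩
    have hx1 : x 1 = c₀ + 1 := by
      have h := hx 1 le_rfl (by omega)
      have hnonneg := (hbij.mapsTo (show 1 ∈ Set.Icc 0 (m + 1) by simp)).1.1
      simp only [Nat.sub_self, hx0, if_true] at h
      rcases hs 1 le_rfl (by omega) with h₁ | h₁ <;> rw [h₁] at h <;> omega
    refine ⟨fun i => s (i + 1), fun i h₁ h₂ => hs (i + 1) (by omega) (by omega),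
      fun i => x (i + 1) - 1, by simp [hx1], fun i h₁ h₂ => ?_,
      (bijOn_Icc_succ_iff_of_shift N B hB m _ x hx0 (by simp)).2 hbij⟩
    have h := hx (i + 1) (by omega) (by omega)
    simp only [Nat.add_sub_cancel, show i + 1 ≠ 1 by omega, if_false] at h
    simp only [Nat.sub_add_cancel h₁, h]
    ring
end

section
/- Let n ≥ 2, let 1 ≤ x₁ < x₂ < ⋯ < x_p ≤ n−1, and let J₁,…,J_m be positive integers with m = n − p − 1 and J_i < n for all i. Set d₁ = x₁, d_i = x_i − x_{i−1} for i = 2,…,p, and d_{p+1} = n − x_p. Then the 1-D Crazy Frog instance with board length n, blocked set {x₁,…,x_p}, starting cell 0, and jumps J₁,…,J_m has a solution if and only if the 1-D Crazy Frog instance with board length 2n+1, empty blocked set, starting cell 0, and jump sequence d₁+1, d₂, …, d_p, d_{p+1}, followed by n−1 jumps of length 1, followed by one jump of length 2n−1, followed by J₁,…,J_m, has a solution. -/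
/-- A sign-free description of solvability: consecutive positions differ by exactly one jump, in
either direction. -/
theorem crazyFrog1D_iff (N : ℕ) (B : Set ℤ) (c₀ : ℤ) (m : ℕ) (J : ℕ → ℤ) :
    CrazyFrog1D N B c₀ m J ↔ ∃ y : ℕ → ℤ, y 0 = c₀ ∧
      (∀ i < m, y (i + 1) = y i + J (i + 1) ∨ y (i + 1) = y i - J (i + 1)) ∧
      (∀ i ≤ m, 0 ≤ y i ∧ y i < N ∧ y i ∉ B) ∧
      (∀ i ≤ m, ∀ j ≤ m, y i = y j → i = j) ∧
      (∀ z : ℤ, 0 ≤ z → z < N → z ∉ B → ∃ i ≤ m, y i = z) := by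
  constructor
  · rintro ⟨s, hs, y, h0, hstep, hmaps, hinj, hsurj⟩
    refine ⟨y, h0, fun i hi => ?_, fun i hi => ?_, fun i hi j hj h => ?_, fun z h1 h2 h3 => ?_⟩
    · have h := hstep (i + 1) (by omega) (by omega)
      rw [Nat.add_sub_cancel] at h
      rcases hs (i + 1) (by omega) (by omega) with e | e <;> rw [e] at h
      · left; linarith
      · right; linarith
    · obtain ⟨⟨h1, h2⟩, h3⟩ := hmaps (⟨Nat.zero_le i, hi⟩ : i ∈ Set.Icc 0 m)
      exact ⟨h1, h2, h3⟩
    · exact hinj ⟨Nat.zero_le i, hi⟩ ⟨Nat.zero_le j, hj⟩ h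
    · obtain ⟨i, hi, e⟩ := hsurj ⟨⟨h1, h2⟩, h3⟩
      exact ⟨i, hi.2, e⟩
  · rintro ⟨y, h0, hstep, hmaps, hinj, hsurj⟩
    classical
    refine ⟨fun i => if y i = y (i - 1) + J i then 1 else -1, fun i _ _ => by grind,
      y, h0, fun i h1 h2 => ?_, fun i hi => ?_, fun i hi j hj h => hinj i hi.2 j hj.2 h, ?_⟩
    · have h := hstep (i - 1) (by omega)
      rw [Nat.sub_add_cancel h1] at h
      dsimp only
      split_ifs with e
      · linarith
      · rcases h with h | h
        · exact absurd h e
        · linarith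
    · obtain ⟨h1, h2, h3⟩ := hmaps i hi.2
      exact ⟨⟨h1, h2⟩, h3⟩
    · rintro z ⟨⟨h1, h2⟩, h3⟩
      obtain ⟨i, hi, e⟩ := hsurj z h1 h2 h3
      exact ⟨i, ⟨Nat.zero_le i, hi⟩, e⟩

/-- A self-avoiding walk on `ℤ` with unit steps is monotone. -/
theorem unit_walk_monotone (f : ℕ → ℤ) (L : ℕ)
    (hstep : ∀ i < L, f (i + 1) = f i + 1 ∨ f (i + 1) = f i - 1)
    (hinj : ∀ i ≤ L, ∀ j ≤ L, f i = f j → i = j) :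
    (∀ i ≤ L, f i = f 0 + i) ∨ (∀ i ≤ L, f i = f 0 - i) := by
  induction L with
  | zero =>
    left
    intro i hi
    obtain rfl : i = 0 := by omega
    simp
  | succ L ih =>
    have hL := hstep L (by omega)
    rcases Nat.eq_zero_or_pos L with rfl | hpos
    · refine hL.imp (fun h i hi => ?_) (fun h i hi => ?_) <;>
        obtain rfl | rfl : i = 0 ∨ i = 1 := by omega
      all_goals simp_all only [Nat.zero_add, Nat.cast_zero, Nat.cast_one, add_zero, sub_zero]
    have hne : f (L + 1) ≠ f (L - 1) := fun h => by
      have := hinj (L + 1) le_rfl (L - 1) (by omega) h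
      omega
    refine (ih (fun i hi => hstep i (by omega))
      (fun i hi j hj => hinj i (by omega) j (by omega))).imp (fun h i hi => ?_) (fun h i hi => ?_)
    all_goals
      have h1 := h L le_rfl
      have h2 := h (L - 1) (by omega)
      rcases Nat.lt_or_ge i (L + 1) with hlt | hge
      · exact h i (by omega)
      · obtain rfl : i = L + 1 := by omega
        push_cast
        omega

/-- A sequence of integers increasing at each step between `1` and `p` is strictly increasing
there. -/
theorem lt_of_forall_lt_succ (p : ℕ) (x : ℕ → ℤ)
    (hx : ∀ i, 1 ≤ i → i < p → x i < x (i + 1)) :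
    ∀ i j, 1 ≤ i → i < j → j ≤ p → x i < x j := by
  intro i j hi hij
  induction j, hij using Nat.le_induction with
  | base => intro hj; exact hx i hi (by omega)
  | succ j hij ih =>
    intro hj
    have h1 := ih (by omega)
    have h2 := hx j (by omega) (by omega)
    omega

/-- The 1-D Crazy Frog instance with board length `n`, blocked
cells `x 1 < x 2 < ⋯ < x p` (with `1 ≤ x 1` and `x p ≤ n - 1`), starting cell `0`
and jumps `J 1, …, J m` (`m = n - p - 1`, `J i < n`) has a solution iff the
instance on an empty board of length `2n+1`, starting cell `0`, with jump
sequence `d₁+1, d₂, …, d_p, d_{p+1}`, then `n-1` jumps of length `1`, then one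
jump of length `2n-1`, then `J 1, …, J m`, has a solution, where `d₁ = x 1`,
`d i = x i - x (i-1)` and `d_{p+1} = n - x p`. -/
theorem stmt_4 (n p m : ℕ) (hn : 2 ≤ n) (hp : 1 ≤ p) (hm : m + p + 1 = n)
    (x : ℕ → ℤ) (hx1 : 1 ≤ x 1) (hxp : x p ≤ (n : ℤ) - 1)
    (hxmono : ∀ i, 1 ≤ i → i < p → x i < x (i + 1))
    (J : ℕ → ℤ) (hJ : ∀ i, 1 ≤ i → i ≤ m → 0 < J i ∧ J i < n) :
    CrazyFrog1D n {z : ℤ | ∃ i, 1 ≤ i ∧ i ≤ p ∧ z = x i} 0 m J ↔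
      CrazyFrog1D (2 * n + 1) ∅ 0 (2 * n)
        (fun i =>
          if i = 1 then x 1 + 1
          else if i ≤ p then x i - x (i - 1)
          else if i = p + 1 then (n : ℤ) - x p
          else if i ≤ p + n then 1
          else if i = p + n + 1 then 2 * n - 1
          else J (i - (p + n + 1))) := by
  have hlt := lt_of_forall_lt_succ p x hxmono
  have hxbd : ∀ i, 1 ≤ i → i ≤ p → 1 ≤ x i ∧ x i ≤ n - 1 := by
    intro i h1 h2
    constructor
    · rcases Nat.eq_or_lt_of_le h1 with rfl | h
      · exact hx1
      · have := hlt 1 i le_rfl h h2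
        omega
    · rcases Nat.eq_or_lt_of_le h2 with rfl | h
      · exact hxp
      · have := hlt i p h1 h le_rfl
        omega
  rw [crazyFrog1D_iff, crazyFrog1D_iff]
  simp only [Set.mem_ofPred_eq, Set.mem_empty_iff_false, not_false_eq_true, and_true,
    forall_const]
  constructor
  · rintro ⟨u, hu0, hstep, hmaps, hinj, hsurj⟩
    obtain ⟨y, hy⟩ : ∃ y : ℕ → ℤ, ∀ i, y i = if i = 0 then 0 else if i ≤ p then x i + 1
        else if i ≤ p + n then (n : ℤ) + i - p else u (i - (p + n + 1)) + 1 := ⟨_, fun _ => rfl⟩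
    have hy0 : y 0 = 0 := by simp [hy]
    have hyx : ∀ i, 1 ≤ i → i ≤ p → y i = x i + 1 := fun i h1 h2 => by grind
    have hyr : ∀ i, p < i → i ≤ p + n → y i = n + i - p := fun i h1 h2 => by grind
    have hyu : ∀ j, y (p + n + 1 + j) = u j + 1 := fun j => by
      rw [hy, if_neg (by omega), if_neg (by omega), if_neg (by omega), Nat.add_sub_cancel_left]
    have cases_index : ∀ i ≤ 2 * n, i = 0 ∨ (1 ≤ i ∧ i ≤ p) ∨ (p < i ∧ i ≤ p + n) ∨
        ∃ j ≤ m, i = p + n + 1 + j := by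
      intro i hi
      by_cases h : i ≤ p + n
      · omega
      · exact Or.inr (Or.inr (Or.inr ⟨i - (p + n + 1), by omega, by omega⟩))
    refine ⟨y, hy0, fun i hi => ?_, fun i hi => ?_, fun i hi j hj h => ?_, fun z h1 h2 => ?_⟩
    · rcases cases_index i (by omega) with rfl | ⟨h1, h2⟩ | ⟨h1, h2⟩ | ⟨j, hj, rfl⟩
      · left
        simp [hy0, hyx 1 le_rfl hp]
      · left
        rw [hyx i h1 h2, if_neg (by omega)]
        rcases Nat.eq_or_lt_of_le h2 with rfl | h
        · rw [hyr (i + 1) (by omega) (by omega), if_neg (by omega), if_pos rfl]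
          push_cast; ring
        · rw [hyx (i + 1) (by omega) (by omega), if_pos (by omega), Nat.add_sub_cancel]
          ring
      · rw [hyr i h1 h2, if_neg (by omega), if_neg (by omega), if_neg (by omega)]
        rcases Nat.eq_or_lt_of_le h2 with rfl | h
        · right
          have h := hyu 0
          rw [Nat.add_zero] at h
          rw [h, hu0, if_neg (by omega), if_pos rfl]
          push_cast; ring
        · left
          rw [hyr (i + 1) (by omega) (by omega), if_pos (by omega)]
          push_cast; ring
      · have h := hyu (j + 1)
        rw [← Nat.add_assoc] at h
        rw [h, hyu, if_neg (by omega), if_neg (by omega), if_neg (by omega), if_neg (by omega),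
          if_neg (by omega), show p + n + 1 + j + 1 - (p + n + 1) = j + 1 by omega]
        have := hstep j (by omega)
        omega
    · rcases cases_index i (by omega) with rfl | ⟨h1, h2⟩ | ⟨h1, h2⟩ | ⟨j, hj, rfl⟩
      · rw [hy0]; omega
      · rw [hyx i h1 h2]
        have := hxbd i h1 h2
        omega
      · rw [hyr i h1 h2]; omega
      · rw [hyu]
        have := hmaps j hj
        omega
    · have hxne : ∀ a b, 1 ≤ a → a ≤ p → b ≤ m → x a ≠ u b := fun a b h1 h2 h3 h4 =>
        (hmaps b h3).2.2 ⟨a, h1, h2, h4.symm⟩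
      have hxinj : ∀ a b, 1 ≤ a → a ≤ p → 1 ≤ b → b ≤ p → x a = x b → a = b := by
        intro a b h1 h2 h3 h4 e
        rcases lt_trichotomy a b with h | h | h
        · exact absurd e (hlt a b h1 h h4).ne
        · exact h
        · exact absurd e (hlt b a h3 h h2).ne'
      have hubd : ∀ a ≤ m, 0 ≤ u a ∧ u a < n := fun a ha =>
        ⟨(hmaps a ha).1, (hmaps a ha).2.1⟩
      clear hstep hmaps hsurj hxmono hJ hlt hy
      rcases cases_index i (by omega) with rfl | ⟨h1, h2⟩ | ⟨h1, h2⟩ | ⟨k, hk, rfl⟩ <;>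
      rcases cases_index j (by omega) with rfl | ⟨h3, h4⟩ | ⟨h3, h4⟩ | ⟨l, hl, rfl⟩ <;>
      clear cases_index <;> grind
    · rcases lt_or_ge (n : ℤ) z with h | h
      · exact ⟨p + (z - n).toNat, by omega, by rw [hyr _ (by omega) (by omega)]; omega⟩
      rcases eq_or_ne z 0 with rfl | hz
      · exact ⟨0, by omega, hy0⟩
      by_cases hB : ∃ i, 1 ≤ i ∧ i ≤ p ∧ z - 1 = x i
      · obtain ⟨i, h3, h4, h5⟩ := hB
        exact ⟨i, by omega, by rw [hyx i h3 h4]; omega⟩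
      · obtain ⟨j, hj, e⟩ := hsurj (z - 1) (by omega) (by omega) hB
        exact ⟨p + n + 1 + j, by omega, by rw [hyu, e]; ring⟩
  · rintro ⟨y, hy0, hstep, hmaps, hinj, hsurj⟩
    have hy1 : y 1 = x 1 + 1 := by
      have h := hstep 0 (by omega)
      have := hmaps 1 (by omega)
      simp only [Nat.zero_add, if_true] at h
      omega
    have hdist : ∀ i ≤ 2 * n, ∀ j ≤ 2 * n, i ≠ j → y i ≠ y j := fun i hi j hj h e =>
      h (hinj i hi j hj e)
    have hrun := unit_walk_monotone (fun i => y (p + 1 + i)) (n - 1) (fun i hi => by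
      have h := hstep (p + 1 + i) (by omega)
      rw [if_neg (by omega), if_neg (by omega), if_neg (by omega), if_pos (by omega)] at h
      exact h) (fun i hi j hj e => by
        have := hinj _ (by omega) _ (by omega) e
        omega)
    have hlong := hstep (p + n) (by omega)
    rw [if_neg (by omega), if_neg (by omega), if_neg (by omega), if_neg (by omega),
      if_pos rfl] at hlong
    have hb0 := hmaps (p + 1) (by omega)
    have hb1 := hmaps (p + n) (by omega)
    have hb2 := hmaps (p + n + 1) (by omega)
    have hz0 := hdist 0 (by omega) (p + 1) (by omega) (by omega)
    have hz1 := hdist 0 (by omega) (p + n) (by omega) (by omega)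
    have hz2 := hdist 0 (by omega) (p + n + 1) (by omega) (by omega)
    have hend : p + 1 + (n - 1) = p + n := by omega
    simp only [Nat.add_zero] at hrun
    have hup : ∀ i ≤ n - 1, y (p + 1 + i) = n + 1 + i := by
      rcases hrun with h | h
      · have he := h (n - 1) le_rfl
        rw [hend] at he
        have : y (p + 1) = n + 1 := by omega
        intro i hi
        rw [h i hi, this]
      · exfalso
        have he := h (n - 1) le_rfl
        rw [hend] at he
        have ha : y (p + 1) = n := by omega
        have hx1n := (hxbd 1 le_rfl hp).2
        have h1 := h (n - 1 - (x 1).toNat) (by omega)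
        refine hdist 1 (by omega) _ (by omega) (by omega)
          (Eq.trans ?_ h1.symm)
        omega
    have hyr : ∀ i, p < i → i ≤ p + n → y i = n + i - p := fun i h1 h2 => by
      have h := hup (i - (p + 1)) (by omega)
      rw [Nat.add_sub_cancel' h1] at h
      omega
    have hys := hyr (p + 1) (by omega) (by omega)
    have hye := hyr (p + n) (by omega) le_rfl
    have hret : y (p + n + 1) = 1 := by omega
    have hdesc : ∀ i j, 1 ≤ i → i ≤ j → j ≤ p → y j - x j ≤ y i - x i := by
      intro i j hi hij
      induction j, hij using Nat.le_induction with
      | base => intro _; exact le_rfl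
      | succ j hij ih =>
        intro hj
        have h1 := ih (by omega)
        have h2 := hstep j (by omega)
        rw [if_neg (by omega), if_pos hj, Nat.add_sub_cancel] at h2
        have h3 := hxmono j (by omega) (by omega)
        omega
    have hlast := hstep p (by omega)
    rw [if_neg (by omega), if_neg (by omega), if_pos rfl] at hlast
    have hyx : ∀ i, 1 ≤ i → i ≤ p → y i = x i + 1 := fun i h1 h2 => by
      have h3 := hdesc 1 i le_rfl h1 h2
      have h4 := hdesc i p h1 h2 le_rfl
      omega
    refine ⟨fun j => y (p + n + 1 + j) - 1, by simp [hret], fun j hj => ?_, fun j hj => ?_,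
      fun i hi j hj h => ?_, fun z h1 h2 hB => ?_⟩
    · have h := hstep (p + n + 1 + j) (by omega)
      rw [if_neg (by omega), if_neg (by omega), if_neg (by omega), if_neg (by omega),
        if_neg (by omega), show p + n + 1 + j + 1 - (p + n + 1) = j + 1 by omega] at h
      simp only [← Nat.add_assoc]
      omega
    · have hb := hmaps (p + n + 1 + j) (by omega)
      have h0 := hdist 0 (by omega) (p + n + 1 + j) (by omega) (by omega)
      have hle : y (p + n + 1 + j) ≤ n := by
        by_contra! hgt
        refine hdist (p + n + 1 + j) (by omega) (p + (y (p + n + 1 + j) - n).toNat) (by omega)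
          (by omega) ?_
        rw [hyr (p + (y (p + n + 1 + j) - n).toNat) (by omega) (by omega)]
        omega
      dsimp only
      refine ⟨by omega, by omega, ?_⟩
      rintro ⟨i, h1, h2, e⟩
      refine hdist i (by omega) (p + n + 1 + j) (by omega) (by omega) ?_
      rw [hyx i h1 h2]
      omega
    · have := hinj (p + n + 1 + i) (by omega) (p + n + 1 + j) (by omega) (by simpa using h)
      omega
    · obtain ⟨k, hk, e⟩ := hsurj (z + 1) (by omega) (by omega)
      have hk0 : k ≠ 0 := by rintro rfl; omega
      have hkp : ¬ k ≤ p := fun h => hB ⟨k, by omega, h, by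
        have := hyx k (by omega) h
        omega⟩
      have hkn : ¬ k ≤ p + n := fun h => by
        have := hyr k (by omega) h
        omega
      refine ⟨k - (p + n + 1), by omega, ?_⟩
      dsimp only
      rw [Nat.add_sub_cancel' (by omega), e]
      ring
end

section
/- Let n ≥ 1, let B ⊆ {0,…,n−1}² be a set of blocked cells of an n × n board, let (x₀,y₀) ∉ B be a starting cell, and let (dx₁,dy₁),…,(dx_m,dy_m) be jumps with (dx_i,dy_i) ≠ (0,0), |dx_i| < n and |dy_i| < n for all i, where m + 1 equals the number of non-blocked cells. Then there exist signs s₁,…,s_m ∈ {−1,+1} such that the 2-D positions p₀ = (x₀,y₀), p_i = p_{i−1} + s_i·(dx_i,dy_i) all lie in {0,…,n−1}², avoid B, are pairwise distinct, and cover all non-blocked cells, if and only if there exist signs s₁,…,s_m ∈ {−1,+1} such that the 1-D positions z₀ = (x₀+n) + 3n·(y₀+n), z_i = z_{i−1} + s_i·(dx_i + 3n·dy_i) all lie in {0,…,9n²−1}, avoid the set of 1-D cells that are not of the form (x+n) + 3n·(y+n) for a non-blocked (x,y) ∈ {0,…,n−1}², are pairwise distinct, and cover all 1-D cells of the form (x+n)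 + 3n·(y+n) with (x,y) ∈ {0,…,n−1}² non-blocked. -/
/-- An integer smaller than `k` in absolute value that is a multiple of `k` vanishes, and so does
the cofactor. -/
theorem eq_zero_and_eq_zero_of_add_mul_eq_zero {k a b : ℤ} (ha : |a| < k) (h : a + k * b = 0) :
    a = 0 ∧ b = 0 := by
  have ha0 : a = 0 := Int.eq_zero_of_abs_lt_dvd (m := k) ⟨-b, by linarith⟩ ha
  have hk : k ≠ 0 := ((abs_nonneg a).trans_lt ha).ne'
  exact ⟨ha0, by simpa [ha0, hk] using h⟩

/-- Row-major position of a board cell after padding with a border of width `n`. -/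
def paddedIndex (n : ℕ) (q : ℤ × ℤ) : ℤ := (q.1 + n) + 3 * n * (q.2 + n)

theorem paddedIndex_add_smul (n : ℕ) (p v : ℤ × ℤ) (t : ℤ) :
    paddedIndex n (p + t • v) = paddedIndex n p + t * (v.1 + 3 * n * v.2) := by
  simp only [paddedIndex, Prod.fst_add, Prod.snd_add, Prod.smul_fst, Prod.smul_snd, smul_eq_mul]
  ring

/-- The padding is wide enough that the line does not wrap around: cells whose first coordinates
are less than `3n` apart are told apart by their index. -/
theorem eq_of_paddedIndex_eq {n : ℕ} {p q : ℤ × ℤ} (hpq : |p.1 - q.1| < 3 * n)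
    (h : paddedIndex n p = paddedIndex n q) : p = q := by
  have hz : (p.1 - q.1) + 3 * n * (p.2 - q.2) = 0 := by
    unfold paddedIndex at h
    linarith
  obtain ⟨h₁, h₂⟩ := eq_zero_and_eq_zero_of_add_mul_eq_zero hpq hz
  exact Prod.ext (by linarith) (by linarith)


/-- The 2-D Crazy Frog Puzzle on an `n × n` board is solvable iff
its 1-D encoding is solvable, where the board (padded by a blocked border of
width `n`) is embedded into a line of `9n²` cells by mapping cell `(x,y)` to
`(x+n) + 3n(y+n)` and each jump `(dx,dy)` to the 1-D jump `dx + 3n·dy`. -/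
theorem stmt_5 (n : ℕ) (hn : 1 ≤ n) (B : Set (ℤ × ℤ))
    (hB : B ⊆ {q : ℤ × ℤ | 0 ≤ q.1 ∧ q.1 < n ∧ 0 ≤ q.2 ∧ q.2 < n})
    (x₀ y₀ : ℤ) (h0 : 0 ≤ x₀ ∧ x₀ < n ∧ 0 ≤ y₀ ∧ y₀ < n) (h0B : (x₀, y₀) ∉ B)
    (m : ℕ) (d : ℕ → ℤ × ℤ)
    (hd : ∀ i, 1 ≤ i → i ≤ m → d i ≠ 0 ∧ |(d i).1| < n ∧ |(d i).2| < n)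
    (hm : ({q : ℤ × ℤ | 0 ≤ q.1 ∧ q.1 < n ∧ 0 ≤ q.2 ∧ q.2 < n} \ B).ncard = m + 1) :
    (∃ s : ℕ → ℤ, (∀ i, 1 ≤ i → i ≤ m → s i = 1 ∨ s i = -1) ∧
      ∃ q : ℕ → ℤ × ℤ, q 0 = (x₀, y₀) ∧
        (∀ i, 1 ≤ i → i ≤ m → q i = q (i - 1) + s i • d i) ∧
        Set.BijOn q (Set.Icc 0 m)
          ({q : ℤ × ℤ | 0 ≤ q.1 ∧ q.1 < n ∧ 0 ≤ q.2 ∧ q.2 < n} \ B)) ↔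
    (∃ s : ℕ → ℤ, (∀ i, 1 ≤ i → i ≤ m → s i = 1 ∨ s i = -1) ∧
      ∃ z : ℕ → ℤ, z 0 = (x₀ + n) + 3 * n * (y₀ + n) ∧
        (∀ i, 1 ≤ i → i ≤ m → z i = z (i - 1) + s i * ((d i).1 + 3 * n * (d i).2)) ∧
        Set.BijOn z (Set.Icc 0 m)
          {c : ℤ | ∃ q ∈ {q : ℤ × ℤ | 0 ≤ q.1 ∧ q.1 < n ∧ 0 ≤ q.2 ∧ q.2 < n} \ B,
            c = (q.1 + n) + 3 * n * (q.2 + n)}) := by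
  set S := {q : ℤ × ℤ | 0 ≤ q.1 ∧ q.1 < n ∧ 0 ≤ q.2 ∧ q.2 < n} \ B
  have himage : {c : ℤ | ∃ q ∈ S, c = (q.1 + n) + 3 * n * (q.2 + n)} = paddedIndex n '' S := by
    ext c
    simp only [Set.mem_ofPred_eq, Set.mem_image, paddedIndex, eq_comm]
  have hinj : Set.InjOn (paddedIndex n) S := by
    rintro p ⟨⟨hp₁, hp₂, -⟩, -⟩ q ⟨⟨hq₁, hq₂, -⟩, -⟩ h
    exact eq_of_paddedIndex_eq (abs_lt.2 ⟨by linarith, by linarith⟩) h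
  have hbij : Set.BijOn (paddedIndex n) S (paddedIndex n '' S) := hinj.bijOn_image
  rw [himage]
  constructor
  · rintro ⟨s, hs, q, hq0, hq, hqS⟩
    refine ⟨s, hs, paddedIndex n ∘ q, by simp [hq0, paddedIndex], fun i hi him ↦ ?_,
      hbij.comp hqS⟩
    simp only [Function.comp_apply, hq i hi him, paddedIndex_add_smul]
  · rintro ⟨s, hs, z, hz0, hz, hzS⟩
    have hinv := hbij.invOn_invFunOn
    set decode := Function.invFunOn (paddedIndex n) S
    have hqS : Set.BijOn (decode ∘ z) (Set.Icc 0 m) S := (hbij.symm hinv.symm).comp hzS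
    have hidx : ∀ i ≤ m, paddedIndex n (decode (z i)) = z i := fun i hi ↦
      hinv.2 (hzS.mapsTo ⟨i.zero_le, hi⟩)
    refine ⟨s, hs, decode ∘ z, ?_, fun i hi him ↦ ?_, hqS⟩
    · exact hinj (hqS.mapsTo ⟨le_rfl, m.zero_le⟩) ⟨h0, h0B⟩ ((hidx 0 m.zero_le).trans hz0)
    · have hstep : |s i * (d i).1| < n := by
        have hd₁ := (hd i hi him).2.1
        rcases hs i hi him with h | h <;> simpa [h] using hd₁
      obtain ⟨⟨ha₁, ha₂, -⟩, -⟩ := hqS.mapsTo ⟨i.zero_le, him⟩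
      obtain ⟨⟨hb₁, hb₂, -⟩, -⟩ := hqS.mapsTo (x := i - 1) ⟨Nat.zero_le _, by omega⟩
      obtain ⟨hl, hr⟩ := abs_lt.1 hstep
      apply eq_of_paddedIndex_eq (n := n)
      · simp only [Prod.fst_add, Prod.smul_fst, smul_eq_mul]
        exact abs_lt.2 ⟨by linarith, by linarith⟩
      · rw [paddedIndex_add_smul]
        simp only [Function.comp_apply]
        rw [hidx i him, hidx (i - 1) (by omega), hz i hi him]
end

section
/- Let k ≥ 2 and w = 2^k − 1. Consider the 1-D board of 3w+2 cells 0,…,3w+1 with blocked cells {w,…,2w−1}, the frog starting at cell 3w, and the jump sequence Z consisting of one jump of length 3w, then w−1 jumps of length 1, then one jump of length w+1, then w−1 jumps of length 1, then one jump of length 2. Then: (1) there exist signs s₁,…,s_{2w+1} ∈ {−1,+1} whose trajectory is legal, visits every non-blocked cell exactly once, and ends at cell 3w+1; (2) every choice of signs whose trajectory is legal visits every non-blocked cell exactly once and ends at cell 3w+1. -/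
/-- The list of positions of a frog starting at `x₀` performing the given list of
(signed) moves. -/
def trajPos (x₀ : ℤ) : List ℤ → List ℤ
  | [] => [x₀]
  | d :: ds => x₀ :: trajPos (x₀ + d) ds

/-- The horizontal fill jump sequence `Z`: one jump of length `3w`, then `w - 1`
jumps of length `1`, then one jump of length `w + 1`, then `w - 1` jumps of
length `1`, then one jump of length `2`. -/
def Zseq (w : ℕ) : List ℤ :=
  (3 * w : ℤ) :: (List.replicate (w - 1) (1 : ℤ) ++
    (w + 1 : ℤ) :: (List.replicate (w - 1) (1 : ℤ) ++ [2]))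

theorem mem_trajPos_self (a : ℤ) (D : List ℤ) : a ∈ trajPos a D := by
  cases D <;> simp [trajPos]

theorem trajPos_replicate_one_append (n : ℕ) (a : ℤ) (D : List ℤ) :
    trajPos a (List.replicate n 1 ++ D) =
      (List.range n).map (fun i : ℕ => a + (i : ℤ)) ++ trajPos (a + n) D := by
  induction n generalizing a with
  | zero => simp
  | succ n ih =>
    rw [List.replicate_succ, List.cons_append, trajPos, ih, List.range_succ_eq_map]
    simp only [List.map_cons, List.map_map, List.cons_append, Nat.cast_zero, add_zero,
      Nat.cast_succ]
    congr 2
    · apply List.map_congr_left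
      intro i _
      simp only [Function.comp_apply, Nat.succ_eq_add_one]
      push_cast
      ring
    · congr 1
      ring

/-- A run of unit jumps that never visits the cell to the left of its start, and never repeats a
cell, goes to the right throughout. -/
theorem zipWith_mul_replicate_one_append (n : ℕ) (a : ℤ) (L s : List ℤ)
    (hlen : s.length = n + L.length) (hs : ∀ σ ∈ s, σ = 1 ∨ σ = -1)
    (hnd : (trajPos a (List.zipWith (· * ·) s (List.replicate n 1 ++ L))).Nodup)
    (hleft : a - 1 ∉ trajPos a (List.zipWith (· * ·) s (List.replicate n 1 ++ L))) :
    ∃ t : List ℤ, t.length = L.length ∧ (∀ σ ∈ t, σ = 1 ∨ σ = -1) ∧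
      List.zipWith (· * ·) s (List.replicate n 1 ++ L) =
        List.replicate n 1 ++ List.zipWith (· * ·) t L := by
  induction n generalizing a s with
  | zero => exact ⟨s, by simpa using hlen, hs, by simp⟩
  | succ n ih =>
    obtain _ | ⟨σ, s⟩ := s
    · simp at hlen
      omega
    simp only [List.replicate_succ, List.cons_append, List.zipWith_cons_cons, mul_one, trajPos,
      List.nodup_cons, List.mem_cons, not_or, List.length_cons] at hlen hnd hleft ⊢
    obtain rfl | rfl := hs σ (by simp)
    · obtain ⟨t, ht, hts, h⟩ := ih (a + 1) s (by omega)
        (fun τ hτ => hs τ (by simp [hτ])) hnd.2 (by simpa using hnd.1)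
      exact ⟨t, ht, hts, by rw [h]⟩
    · exact absurd (mem_trajPos_self _ _) hleft.2

/-- The signed moves of the only legal trajectory. -/
def fillMoves (w : ℕ) : List ℤ :=
  (-(3 * w) : ℤ) :: (List.replicate (w - 1) (1 : ℤ) ++
    (w + 1 : ℤ) :: (List.replicate (w - 1) (1 : ℤ) ++ [2]))

theorem trajPos_fillMoves (w : ℕ) (hw : 1 ≤ w) :
    trajPos (3 * w) (fillMoves w) =
      (3 * w : ℤ) :: ((List.range w).map (fun i : ℕ => (i : ℤ)) ++
        ((List.range w).map (fun i : ℕ => (2 * w + i : ℤ)) ++ [(3 * w + 1 : ℤ)])) := by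
  obtain ⟨v, rfl⟩ : ∃ v, w = v + 1 := ⟨w - 1, by omega⟩
  simp only [fillMoves, trajPos, trajPos_replicate_one_append, Nat.add_sub_cancel,
    List.range_succ, List.map_append, List.map_cons, List.map_nil, List.append_assoc,
    List.cons_append, List.nil_append, add_neg_cancel, zero_add]
  push_cast
  have e₁ : (v : ℤ) + (v + 1 + 1) = 2 * (v + 1) := by ring
  have e₂ : 2 * ((v : ℤ) + 1) + v + 2 = 3 * (v + 1) + 1 := by ring
  rw [e₁, e₂]

theorem mem_trajPos_fillMoves (w : ℕ) (hw : 1 ≤ w) (q : ℤ) :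
    q ∈ trajPos (3 * w) (fillMoves w) ↔
      (0 ≤ q ∧ q ≤ 3 * w + 1) ∧ ¬((w : ℤ) ≤ q ∧ q ≤ 2 * w - 1) := by
  rw [trajPos_fillMoves w hw]
  simp only [List.mem_cons, List.mem_append, List.mem_map, List.mem_range, List.not_mem_nil,
    or_false]
  constructor
  · rintro (h | ⟨i, hi, h⟩ | ⟨i, hi, h⟩ | h) <;> omega
  · intro h
    by_cases h₁ : q < w
    · exact Or.inr (Or.inl ⟨q.toNat, by omega, by omega⟩)
    by_cases h₂ : q < 3 * w
    · exact Or.inr (Or.inr (Or.inl ⟨(q - 2 * w).toNat, by omega, by omega⟩))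
    omega

theorem nodup_trajPos_fillMoves (w : ℕ) (hw : 1 ≤ w) :
    (trajPos (3 * w) (fillMoves w)).Nodup := by
  rw [trajPos_fillMoves w hw, List.nodup_cons, List.nodup_append', List.nodup_append']
  refine ⟨?_, ?_, ⟨?_, by simp, ?_⟩, ?_⟩
  · simp only [List.mem_cons, List.mem_append, List.mem_map, List.mem_range, List.not_mem_nil,
      or_false]
    rintro (⟨i, hi, h⟩ | ⟨i, hi, h⟩ | h) <;> omega
  · exact List.nodup_range.map fun i j h => by simpa using h
  · exact List.nodup_range.map fun i j h => by simpa using h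
  · intro q h₁ h₂
    simp only [List.mem_cons, List.mem_map, List.mem_range, List.not_mem_nil, or_false] at h₁ h₂
    obtain ⟨i, hi, h⟩ := h₁
    omega
  · intro q h₁ h₂
    simp only [List.mem_cons, List.mem_append, List.mem_map, List.mem_range, List.not_mem_nil,
      or_false] at h₁ h₂
    obtain ⟨i, hi, h⟩ := h₁
    obtain ⟨j, hj, h'⟩ | h' := h₂ <;> omega

theorem getLast?_trajPos_fillMoves (w : ℕ) (hw : 1 ≤ w) :
    (trajPos (3 * w) (fillMoves w)).getLast? = some (3 * w + 1 : ℤ) := by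
  rw [trajPos_fillMoves w hw, ← List.append_assoc, ← List.cons_append, List.getLast?_concat]

theorem zipWith_mul_map_one (L : List ℤ) :
    List.zipWith (· * ·) (L.map fun _ => (1 : ℤ)) L = L := by
  induction L with
  | nil => rfl
  | cons a L ih => rw [List.map_cons, List.zipWith_cons_cons, ih, one_mul]

/-- A legal trajectory for the jump sequence `Z` has the moves `fillMoves w`. -/
theorem zipWith_mul_Zseq_eq_fillMoves (w : ℕ) (hw : 3 ≤ w) (s : List ℤ)
    (hlen : s.length = (Zseq w).length) (hs : ∀ σ ∈ s, σ = 1 ∨ σ = -1)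
    (hnd : (trajPos (3 * w) (List.zipWith (· * ·) s (Zseq w))).Nodup)
    (hP : ∀ q ∈ trajPos (3 * w) (List.zipWith (· * ·) s (Zseq w)),
      (0 ≤ q ∧ q ≤ 3 * w + 1) ∧ ¬((w : ℤ) ≤ q ∧ q ≤ 2 * w - 1)) :
    List.zipWith (· * ·) s (Zseq w) = fillMoves w := by
  unfold Zseq at *
  obtain _ | ⟨σ, s⟩ := s
  · simp at hlen
  simp only [List.zipWith_cons_cons, trajPos, List.length_cons] at hlen hnd hP ⊢
  have hs₀ := hs σ (by simp)
  replace hs : ∀ τ ∈ s, τ = 1 ∨ τ = -1 := fun τ hτ => hs τ (by simp [hτ])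
  obtain rfl : σ = -1 := by
    have := hP _ (List.mem_cons_of_mem _ (mem_trajPos_self _ _))
    obtain rfl | rfl := hs₀ <;> omega
  have e₀ : (3 * w : ℤ) + -1 * (3 * w) = 0 := by ring
  rw [e₀] at hnd hP
  replace hnd := (List.nodup_cons.1 hnd).2
  replace hP := fun q hq => hP q (List.mem_cons_of_mem _ hq)
  obtain ⟨t, htlen, ht, hst⟩ := zipWith_mul_replicate_one_append (w - 1) 0 _ s
    (by simp only [List.length_append, List.length_replicate, List.length_cons] at hlen ⊢; omega)
    hs hnd (fun h => by have := hP _ h; omega)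
  rw [hst, trajPos_replicate_one_append] at hnd hP
  rw [hst]
  replace hnd := (List.nodup_append'.1 hnd).2.1
  replace hP := fun q hq => hP q (List.mem_append_right _ hq)
  obtain _ | ⟨τ, t⟩ := t
  · simp at htlen
  simp only [List.zipWith_cons_cons, trajPos, List.length_cons] at htlen hnd hP ⊢
  have ht₀ := ht τ (by simp)
  replace ht : ∀ σ ∈ t, σ = 1 ∨ σ = -1 := fun σ hσ => ht σ (by simp [hσ])
  obtain rfl : τ = 1 := by
    have := hP _ (List.mem_cons_of_mem _ (mem_trajPos_self _ _))
    obtain rfl | rfl := ht₀ <;> omega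
  have e₁ : (0 : ℤ) + ((w - 1 : ℕ) : ℤ) + 1 * (w + 1) = 2 * w := by omega
  rw [e₁] at hnd hP
  replace hnd := (List.nodup_cons.1 hnd).2
  replace hP := fun q hq => hP q (List.mem_cons_of_mem _ hq)
  obtain ⟨u, hulen, hu, htu⟩ := zipWith_mul_replicate_one_append (w - 1) (2 * w) [2] t
    (by simp only [List.length_append, List.length_replicate, List.length_cons] at htlen ⊢; omega)
    ht hnd (fun h => by have := hP _ h; omega)
  rw [htu, trajPos_replicate_one_append] at hnd
  rw [htu]
  obtain ⟨ρ, rfl⟩ := List.length_eq_one_iff.1 hulen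
  obtain rfl | rfl := hu ρ (by simp)
  · simp [fillMoves]
  · refine absurd ?_ (List.disjoint_of_nodup_append hnd (a := 3 * w - 3) ?_)
    · have e₂ : (2 * w : ℤ) + ((w - 1 : ℕ) : ℤ) + -1 * 2 = 3 * w - 3 := by omega
      simp only [List.zipWith_cons_cons, List.zipWith_nil_left, trajPos, e₂]
      simp
    · exact List.mem_map.2 ⟨w - 3, List.mem_range.2 (by omega), by omega⟩

/-- **Horizontal fill sequence.** Let `k ≥ 2`, `w = 2^k - 1`.
On the board `0,…,3w+1` with blocked cells `{w,…,2w-1}` and the frog starting at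
cell `3w`, with the jump sequence `Z`: (1) some choice of signs gives a legal
trajectory that visits every non-blocked cell exactly once and ends at `3w+1`;
(2) every choice of signs giving a legal trajectory visits every non-blocked
cell exactly once and ends at `3w+1`. -/
theorem stmt_8 (k : ℕ) (hk : 2 ≤ k) (w : ℕ) (hw : w = 2 ^ k - 1) :
    (∃ s : List ℤ, s.length = (Zseq w).length ∧ (∀ σ ∈ s, σ = 1 ∨ σ = -1) ∧
      (trajPos (3 * w) (List.zipWith (· * ·) s (Zseq w))).Nodup ∧
      (∀ q ∈ trajPos (3 * w) (List.zipWith (· * ·) s (Zseq w)),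
        (0 ≤ q ∧ q ≤ 3 * w + 1) ∧ ¬((w : ℤ) ≤ q ∧ q ≤ 2 * w - 1)) ∧
      (∀ c : ℤ, 0 ≤ c → c ≤ 3 * w + 1 → ¬((w : ℤ) ≤ c ∧ c ≤ 2 * w - 1) →
        c ∈ trajPos (3 * w) (List.zipWith (· * ·) s (Zseq w))) ∧
      (trajPos (3 * w) (List.zipWith (· * ·) s (Zseq w))).getLast? =
        some (3 * w + 1)) ∧
    (∀ s : List ℤ, s.length = (Zseq w).length → (∀ σ ∈ s, σ = 1 ∨ σ = -1) →
      (trajPos (3 * w) (List.zipWith (· * ·) s (Zseq w))).Nodup →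
      (∀ q ∈ trajPos (3 * w) (List.zipWith (· * ·) s (Zseq w)),
        (0 ≤ q ∧ q ≤ 3 * w + 1) ∧ ¬((w : ℤ) ≤ q ∧ q ≤ 2 * w - 1)) →
      (∀ c : ℤ, 0 ≤ c → c ≤ 3 * w + 1 → ¬((w : ℤ) ≤ c ∧ c ≤ 2 * w - 1) →
        c ∈ trajPos (3 * w) (List.zipWith (· * ·) s (Zseq w))) ∧
      (trajPos (3 * w) (List.zipWith (· * ·) s (Zseq w))).getLast? =
        some (3 * w + 1)) := by
  have hw3 : 3 ≤ w := by
    have := Nat.pow_le_pow_right (n := 2) (by norm_num) hk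
    omega
  have hw1 : 1 ≤ w := by omega
  refine ⟨⟨-1 :: (Zseq w).tail.map fun _ => 1, by simp [Zseq], ?_, ?_⟩, ?_⟩
  · intro σ hσ
    simp only [List.mem_cons, List.mem_map] at hσ
    obtain rfl | ⟨_, _, rfl⟩ := hσ <;> simp
  · have h : List.zipWith (· * ·) (-1 :: (Zseq w).tail.map fun _ => (1 : ℤ)) (Zseq w) =
        fillMoves w := by
      rw [Zseq, List.tail_cons, List.zipWith_cons_cons, zipWith_mul_map_one, neg_one_mul,
        fillMoves]
    rw [h]
    exact ⟨nodup_trajPos_fillMoves w hw1, fun q hq => (mem_trajPos_fillMoves w hw1 q).1 hq,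
      fun c h₀ h₁ h₂ => (mem_trajPos_fillMoves w hw1 c).2 ⟨⟨h₀, h₁⟩, h₂⟩,
      getLast?_trajPos_fillMoves w hw1⟩
  · intro s hlen hs hnd hP
    rw [zipWith_mul_Zseq_eq_fillMoves w hw3 s hlen hs hnd hP]
    exact ⟨fun c h₀ h₁ h₂ => (mem_trajPos_fillMoves w hw1 c).2 ⟨⟨h₀, h₁⟩, h₂⟩,
      getLast?_trajPos_fillMoves w hw1⟩
end

section
/- Let k ≥ 2, w = 2^k − 1, and l ≥ w + 5. Consider the 2-D board with columns 0,…,w−1 and rows 0,…,l+7w−1, in which every cell of the rows l,…,l+7w−1 is blocked except that the rows l+2w+2j and l+4w+2j for 0 ≤ j ≤ (w−1)/2 are entirely non-blocked (the rows 0,…,l−1 carry an arbitrary blocked/non-blocked pattern). Let the frog start at a non-blocked cell (x,y) with 4 ≤ x ≤ w−5, y even, and 4 ≤ y ≤ min(w−5, l−5), and consider the jump sequence (0, l+2w), (2,2), (0,2w), (2,−2), (0, l+4w). Then: (1) for every choice of signs s₁,…,s₅ ∈ {−1,+1} such that the first four positions of the trajectory lie on non-blocked cells of the rows l,…,l+7w−1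 and the fifth position lies on the board, one has s₁ = +1, s₃ = +1, s₅ = −1, and the final position equals (x + 2s₂ + 2s₄, y + 2s₂ − 2s₄), which is one of the four cells (x+4,y), (x−4,y), (x,y+4), (x,y−4); (2) conversely, for each of the four choices (s₂,s₄) ∈ {−1,+1}², the signs (+1, s₂, +1, s₄, −1) yield a trajectory whose first four positions are pairwise distinct non-blocked cells of the rows l,…,l+7w−1 and whose final position is (x + 2s₂ + 2s₄, y + 2s₂ − 2s₄), lying in the rows 0,…,l−1. -/
/-- The non-blocked cells of the edge gadget rows `l,…,l+7w-1` (columns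
`0,…,w-1`): the rows `l+2w+2j` and `l+4w+2j` for `0 ≤ j ≤ (w-1)/2` are entirely
non-blocked and every other cell of these rows is blocked. -/
def EdgeStripNB (w l : ℕ) (q : ℤ × ℤ) : Prop :=
  0 ≤ q.1 ∧ q.1 < w ∧
    ∃ j : ℤ, 0 ≤ j ∧ j ≤ ((w : ℤ) - 1) / 2 ∧
      (q.2 = l + 2 * w + 2 * j ∨ q.2 = l + 4 * w + 2 * j)

/-- The five jumps of the edge gadget: `(0, l+2w)`, `(2,2)`, `(0,2w)`, `(2,-2)`,
`(0, l+4w)`. -/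
def edgeJump (w l : ℕ) : ℕ → ℤ × ℤ := fun i =>
  match i with
  | 1 => ((0 : ℤ), (l : ℤ) + 2 * w)
  | 2 => (2, 2)
  | 3 => ((0 : ℤ), 2 * (w : ℤ))
  | 4 => (2, -2)
  | 5 => ((0 : ℤ), (l : ℤ) + 4 * w)
  | _ => 0

/-- The five positions after the start of a trajectory of the edge gadget. -/
theorem edgeJump_trajectory {w l : ℕ} {s : ℕ → ℤ} {p : ℕ → ℤ × ℤ} {x y : ℤ}
    (hp0 : p 0 = (x, y))
    (hp : ∀ i, 1 ≤ i → i ≤ 5 → p i = p (i - 1) + s i • edgeJump w l i) :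
    p 1 = (x, y + s 1 * (l + 2 * w)) ∧
    p 2 = (x + s 2 * 2, y + s 1 * (l + 2 * w) + s 2 * 2) ∧
    p 3 = (x + s 2 * 2, y + s 1 * (l + 2 * w) + s 2 * 2 + s 3 * (2 * w)) ∧
    p 4 = (x + s 2 * 2 + s 4 * 2,
      y + s 1 * (l + 2 * w) + s 2 * 2 + s 3 * (2 * w) - s 4 * 2) ∧
    p 5 = (x + s 2 * 2 + s 4 * 2,
      y + s 1 * (l + 2 * w) + s 2 * 2 + s 3 * (2 * w) - s 4 * 2 + s 5 * (l + 4 * w)) := by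
  have h1 := hp 1 (by omega) (by omega)
  have h2 := hp 2 (by omega) (by omega)
  have h3 := hp 3 (by omega) (by omega)
  have h4 := hp 4 (by omega) (by omega)
  have h5 := hp 5 (by omega) (by omega)
  simp [edgeJump, hp0] at h1
  simp [edgeJump, h1] at h2
  simp [edgeJump, h2] at h3
  simp [edgeJump, h3] at h4
  simp [edgeJump, h4] at h5
  simp [h1, h2, h3, h4, h5, sub_eq_add_neg]

/-- **Edge gadget.** Let `k ≥ 2`, `w = 2^k - 1`, `l ≥ w + 5`, and
let the frog start at `(x,y)` with `4 ≤ x ≤ w-5`, `y` even, `4 ≤ y ≤ min (w-5) (l-5)`.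
(1) Any signs whose trajectory keeps the first four positions on non-blocked
cells of the rows `l,…,l+7w-1` and the fifth position on the board must have
`s 1 = 1`, `s 3 = 1`, `s 5 = -1`, and end at `(x + 2·s 2 + 2·s 4, y + 2·s 2 - 2·s 4)`,
one of the four cells `(x±4, y)`, `(x, y±4)`.
(2) Conversely each of the four sign choices `(s 2, s 4) ∈ {±1}²` together with
`s 1 = 1`, `s 3 = 1`, `s 5 = -1` yields four pairwise distinct non-blocked
positions in the rows `l,…,l+7w-1` and a final position
`(x + 2·s 2 + 2·s 4, y + 2·s 2 - 2·s 4)` lying in the rows `0,…,l-1`. -/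
theorem stmt_12 (k w l : ℕ) (hk : 2 ≤ k) (hw : w = 2 ^ k - 1) (hl : w + 5 ≤ l)
    (x y : ℤ) (hx4 : 4 ≤ x) (hxw : x ≤ (w : ℤ) - 5)
    (hy : Even y) (hy4 : 4 ≤ y) (hyw : y ≤ (w : ℤ) - 5) (hyl : y ≤ (l : ℤ) - 5) :
    (∀ s : ℕ → ℤ, (∀ i, 1 ≤ i → i ≤ 5 → s i = 1 ∨ s i = -1) →
      ∀ p : ℕ → ℤ × ℤ, p 0 = (x, y) →
      (∀ i, 1 ≤ i → i ≤ 5 → p i = p (i - 1) + s i • edgeJump w l i) →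
      (∀ i, 1 ≤ i → i ≤ 4 → EdgeStripNB w l (p i)) →
      (0 ≤ (p 5).1 ∧ (p 5).1 < w ∧ 0 ≤ (p 5).2 ∧ (p 5).2 < l + 7 * w) →
      s 1 = 1 ∧ s 3 = 1 ∧ s 5 = -1 ∧
        p 5 = (x + 2 * s 2 + 2 * s 4, y + 2 * s 2 - 2 * s 4) ∧
        (p 5 = (x + 4, y) ∨ p 5 = (x - 4, y) ∨ p 5 = (x, y + 4) ∨ p 5 = (x, y - 4))) ∧
    (∀ s : ℕ → ℤ, (s 2 = 1 ∨ s 2 = -1) → (s 4 = 1 ∨ s 4 = -1) →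
      s 1 = 1 → s 3 = 1 → s 5 = -1 →
      ∀ p : ℕ → ℤ × ℤ, p 0 = (x, y) →
      (∀ i, 1 ≤ i → i ≤ 5 → p i = p (i - 1) + s i • edgeJump w l i) →
      (∀ i, 1 ≤ i → i ≤ 4 → EdgeStripNB w l (p i)) ∧
        (∀ i j, 1 ≤ i → i ≤ 4 → 1 ≤ j → j ≤ 4 → p i = p j → i = j) ∧
        p 5 = (x + 2 * s 2 + 2 * s 4, y + 2 * s 2 - 2 * s 4) ∧
        0 ≤ (p 5).1 ∧ (p 5).1 < w ∧ 0 ≤ (p 5).2 ∧ (p 5).2 < l) := by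
  obtain ⟨a, ha⟩ := hy
  constructor
  · intro s hs p hp0 hp hNB hb
    obtain ⟨h1, h2, h3, h4, h5⟩ := edgeJump_trajectory hp0 hp
    obtain ⟨-, -, j₁, hj₁, -, hr₁⟩ := hNB 1 (by omega) (by omega)
    obtain ⟨-, -, j₃, hj₃, -, hr₃⟩ := hNB 3 (by omega) (by omega)
    have hs1 := hs 1 (by omega) (by omega)
    have hs2 := hs 2 (by omega) (by omega)
    have hs3 := hs 3 (by omega) (by omega)
    have hs4 := hs 4 (by omega) (by omega)
    have hs5 := hs 5 (by omega) (by omega)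
    rw [h5] at hb
    rw [h1] at hr₁
    rw [h3] at hr₃
    rw [h5]
    simp only [Prod.mk.injEq] at hb hr₁ hr₃ ⊢
    have e1 : s 1 = 1 := by
      rcases hs1 with h | h
      · exact h
      · rw [h] at hr₁; omega
    rw [e1] at hr₃ hb ⊢
    have e3 : s 3 = 1 := by
      rcases hs3 with h | h
      · exact h
      · rw [h] at hr₃; omega
    rw [e3] at hb ⊢
    have e5 : s 5 = -1 := by
      rcases hs5 with h | h
      · rw [h] at hb; omega
      · exact h
    rw [e5]
    omega
  · intro s hs2 hs4 e1 e3 e5 p hp0 hp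
    obtain ⟨h1, h2, h3, h4, h5⟩ := edgeJump_trajectory hp0 hp
    rw [e1] at h1 h2 h3 h4 h5
    rw [e3] at h3 h4 h5
    rw [e5] at h5
    refine ⟨fun i hi hi' => ?_, fun i j hi hi' hj hj' hij => ?_, ?_⟩
    · interval_cases i
      · rw [h1]; exact ⟨by omega, by omega, a, by omega, by omega, by dsimp only; omega⟩
      · rw [h2]
        exact ⟨by dsimp only; omega, by dsimp only; omega, a + s 2, by omega, by omega,
          by dsimp only; omega⟩
      · rw [h3]
        exact ⟨by dsimp only; omega, by dsimp only; omega, a + s 2, by omega, by omega,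
          by dsimp only; omega⟩
      · rw [h4]
        exact ⟨by dsimp only; omega, by dsimp only; omega, a + s 2 - s 4, by omega, by omega,
          by dsimp only; omega⟩
    · interval_cases i <;> interval_cases j <;>
        simp only [h1, h2, h3, h4, Prod.mk.injEq] at hij <;> omega
    · rw [h5]
      simp only [Prod.mk.injEq]
      omega
end
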